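/- Let G be a finite graph with a percolation measure, let a₁, a₂, b be vertices and δ > 0 such that P(a₁↔b) < P(a₂↔b) + δ. If Q is an increasing event determined by the cluster of a₂, then P(a₁↔b | Q) < P(a₂↔b | Q) + δ. -/

import Mathlib

open scoped BigOperators

structure PercGraph (V E : Type) where
  ends : E → V × V
  p : E → ℝ

namespace PercGraph

variable {V E : Type} [DecidableEq V] [Fintype E] [DecidableEq E]

/-- Weight of a configuration: each edge `e` is open (`ω e = true`) with probability `p e`. -/
def weight (G : PercGraph V E) (ω : E → Bool) : ℝ :=
  ∏ e, if ω e then G.p e else 1 - G.p e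

/-- Probability of an event under the percolation measure. -/
noncomputable def prob (G : PercGraph V E) (S : Set (E → Bool)) : ℝ :=
  ∑ ω : E → Bool, Set.indicator S G.weight ω

/-- Expectation of a function under the percolation measure. -/
noncomputable def expec (G : PercGraph V E) (f : (E → Bool) → ℝ) : ℝ :=
  ∑ ω : E → Bool, f ω * G.weight ω

/-- Two vertices are adjacent via an open edge in configuration `ω`. -/
def adj (G : PercGraph V E) (ω : E → Bool) (x y : V) : Prop :=
  ∃ e, ω e = true ∧ (G.ends e = (x, y) ∨ G.ends e = (y, x))

/-- `x` and `y` are connected by a path of open edges. -/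
def Conn (G : PercGraph V E) (ω : E → Bool) (x y : V) : Prop :=
  Relation.ReflTransGen (G.adj ω) x y

/-- The union of the open clusters of the vertices of `A`. -/
def cluster (G : PercGraph V E) (ω : E → Bool) (A : Set V) : Set V :=
  {y | ∃ a ∈ A, G.Conn ω a y}

/-- The event `x ↔ y`. -/
def connEvent (G : PercGraph V E) (x y : V) : Set (E → Bool) :=
  {ω | G.Conn ω x y}

/-- The event `x ↔ A`. -/
def connTo (G : PercGraph V E) (x : V) (A : Set V) : Set (E → Bool) :=
  {ω | ∃ a ∈ A, G.Conn ω x a}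

/-- The event `A ↮ B`. -/
def disconn (G : PercGraph V E) (A B : Set V) : Set (E → Bool) :=
  {ω | ∀ a ∈ A, ∀ b ∈ B, ¬ G.Conn ω a b}

def IncreasingEvent (S : Set (E → Bool)) : Prop :=
  ∀ ⦃ω ω' : E → Bool⦄, (∀ e, ω e = true → ω' e = true) → ω ∈ S → ω' ∈ S

def DecreasingEvent (S : Set (E → Bool)) : Prop :=
  ∀ ⦃ω ω' : E → Bool⦄, (∀ e, ω e = true → ω' e = true) → ω' ∈ S → ω ∈ S

def IncreasingFun (f : (E → Bool) → ℝ) : Prop :=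
  ∀ ⦃ω ω' : E → Bool⦄, (∀ e, ω e = true → ω' e = true) → f ω ≤ f ω'

/-- `f` is determined by the cluster of `A`. -/
def ClusterDetermined (G : PercGraph V E) (A : Set V) (f : (E → Bool) → ℝ) : Prop :=
  ∀ ω ω', G.cluster ω A = G.cluster ω' A → f ω = f ω'

/-- The event `S` is determined by the cluster of `A`. -/
def ClusterDeterminedEvent (G : PercGraph V E) (A : Set V) (S : Set (E → Bool)) : Prop :=
  ∀ ω ω', G.cluster ω A = G.cluster ω' A → (ω ∈ S ↔ ω' ∈ S)

noncomputable def condProb (G : PercGraph V E) (S T : Set (E → Bool)) : ℝ :=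
  G.prob (S ∩ T) / G.prob T

noncomputable def condExpec (G : PercGraph V E) (f : (E → Bool) → ℝ) (T : Set (E → Bool)) : ℝ :=
  G.expec (T.indicator f) / G.prob T

/-- The edge `e` is incident to the vertex `x`. -/
def incident (G : PercGraph V E) (x : V) (e : E) : Prop :=
  (G.ends e).1 = x ∨ (G.ends e).2 = x

/-- The other endpoint of an edge incident to `x`. -/
def otherEnd (G : PercGraph V E) (x : V) (e : E) : V :=
  if (G.ends e).1 = x then (G.ends e).2 else (G.ends e).1

/-- The graph `G ∖ W`: delete the vertices of `W` and all incident edges. -/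
def delete (G : PercGraph V E) (W : Finset V) :
    PercGraph V {e : E // (G.ends e).1 ∉ W ∧ (G.ends e).2 ∉ W} :=
  ⟨fun e => G.ends e.1, fun e => G.p e.1⟩

/-- The graph `G` with the probability of edge `e` replaced by `q`. -/
def withEdgeProb (G : PercGraph V E) (e : E) (q : ℝ) : PercGraph V E :=
  ⟨G.ends, Function.update G.p e q⟩

/-- Contraction of the edge `e`: set its probability to 1. -/
def contract (G : PercGraph V E) (e : E) : PercGraph V E :=
  G.withEdgeProb e 1

/-- The event that `e` is pivotal for `U`. -/
def pivotal (e : E) (U : Set (E → Bool)) : Set (E → Bool) :=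
  {ω | ¬ ((Function.update ω e true ∈ U) ↔ (Function.update ω e false ∈ U))}

/-- All edge probabilities lie in `[0,1]`. -/
def ProbValid (G : PercGraph V E) : Prop := ∀ e, 0 ≤ G.p e ∧ G.p e ≤ 1

end PercGraph

namespace PercGraph

section Bernoulli

variable {E : Type} [Fintype E]

/-- Weight of `ω` under the product of Bernoulli measures with parameters `p`. -/
noncomputable def bernoulliWeight (p : E → ℝ) (ω : E → Bool) : ℝ :=
  ∏ e, if ω e then p e else 1 - p e

lemma bernoulliWeight_nonneg {p : E → ℝ} (hp : ∀ e, 0 ≤ p e ∧ p e ≤ 1) (ω : E → Bool) :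
    0 ≤ bernoulliWeight p ω := by
  refine Finset.prod_nonneg fun e _ => ?_
  split_ifs
  · exact (hp e).1
  · linarith [(hp e).2]

lemma bernoulliWeight_eq_zero {p : E → ℝ} {ω : E → Bool} {e : E} (hω : ω e = true)
    (he : p e = 0) : bernoulliWeight p ω = 0 :=
  Finset.prod_eq_zero (Finset.mem_univ e) (by simp [hω, he])

lemma bernoulliWeight_mul_le (p : E → ℝ) (ω ω' : E → Bool) :
    bernoulliWeight p ω * bernoulliWeight p ω' ≤
      bernoulliWeight p (ω ⊓ ω') * bernoulliWeight p (ω ⊔ ω') := by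
  refine le_of_eq ?_
  simp only [bernoulliWeight, ← Finset.prod_mul_distrib]
  refine Finset.prod_congr rfl fun e _ => ?_
  cases h : ω e <;> cases h' : ω' e <;> simp [h, h', mul_comm]

variable [DecidableEq E]

/-- Expectation under the product of Bernoulli measures with parameters `p`. -/
noncomputable def bernoulliExp (p : E → ℝ) (f : (E → Bool) → ℝ) : ℝ :=
  ∑ ω, f ω * bernoulliWeight p ω

lemma sum_bernoulliWeight (p : E → ℝ) : ∑ ω, bernoulliWeight p ω = 1 := by
  have := Finset.prod_univ_sum (fun _ : E => (Finset.univ : Finset Bool))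
    (fun e b => if b then p e else 1 - p e)
  simp only [Fintype.piFinset_univ] at this
  simp only [bernoulliWeight]
  rw [← this]
  simp

lemma bernoulliExp_one (p : E → ℝ) : bernoulliExp p 1 = 1 := by
  simp [bernoulliExp, sum_bernoulliWeight]

lemma bernoulliExp_sub (p : E → ℝ) (f g : (E → Bool) → ℝ) :
    bernoulliExp p (f - g) = bernoulliExp p f - bernoulliExp p g := by
  simp [bernoulliExp, sub_mul]

lemma bernoulliExp_nonneg {p : E → ℝ} (hp : ∀ e, 0 ≤ p e ∧ p e ≤ 1) {f : (E → Bool) → ℝ}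
    (hf : 0 ≤ f) : 0 ≤ bernoulliExp p f :=
  Finset.sum_nonneg fun ω _ => mul_nonneg (hf ω) (bernoulliWeight_nonneg hp ω)

lemma bernoulliExp_mono {p : E → ℝ} (hp : ∀ e, 0 ≤ p e ∧ p e ≤ 1) {f g : (E → Bool) → ℝ}
    (hfg : f ≤ g) : bernoulliExp p f ≤ bernoulliExp p g :=
  Finset.sum_le_sum fun ω _ => mul_le_mul_of_nonneg_right (hfg ω) (bernoulliWeight_nonneg hp ω)

lemma bernoulliExp_congr {p : E → ℝ} {f g : (E → Bool) → ℝ}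
    (h : ∀ ω, (∀ e, ω e = true → p e ≠ 0) → f ω = g ω) :
    bernoulliExp p f = bernoulliExp p g := by
  refine Finset.sum_congr rfl fun ω _ => ?_
  by_cases hω : ∀ e, ω e = true → p e ≠ 0
  · rw [h ω hω]
  · push Not at hω
    obtain ⟨e, he, hpe⟩ := hω
    simp [bernoulliWeight_eq_zero he hpe]

/-- The Harris inequality. -/
lemma bernoulliExp_mul_le {p : E → ℝ} (hp : ∀ e, 0 ≤ p e ∧ p e ≤ 1) {f g : (E → Bool) → ℝ}
    (hf₀ : 0 ≤ f) (hg₀ : 0 ≤ g) (hf : Monotone f) (hg : Monotone g) :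
    bernoulliExp p f * bernoulliExp p g ≤ bernoulliExp p (f * g) := by
  have := fkg _ _ _ (bernoulliWeight_nonneg hp) hf₀ hg₀ hf hg (bernoulliWeight_mul_le p)
  simpa [bernoulliExp, sum_bernoulliWeight, mul_comm] using this

lemma bernoulliExp_mul_antitone_le {p : E → ℝ} (hp : ∀ e, 0 ≤ p e ∧ p e ≤ 1)
    {f g : (E → Bool) → ℝ} (hf₀ : 0 ≤ f) (hg₁ : g ≤ 1) (hf : Monotone f) (hg : Antitone g) :
    bernoulliExp p (f * g) ≤ bernoulliExp p f * bernoulliExp p g := by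
  have := bernoulliExp_mul_le hp hf₀ (sub_nonneg.2 hg₁) hf (fun a b h => sub_le_sub_left (hg h) 1)
  rw [mul_sub, mul_one, bernoulliExp_sub, bernoulliExp_sub, bernoulliExp_one] at this
  linarith

lemma bernoulliExp_antitone_mul_le {p : E → ℝ} (hp : ∀ e, 0 ≤ p e ∧ p e ≤ 1)
    {f g : (E → Bool) → ℝ} (hf₁ : f ≤ 1) (hg₁ : g ≤ 1) (hf : Antitone f) (hg : Antitone g) :
    bernoulliExp p f * bernoulliExp p g ≤ bernoulliExp p (f * g) := by
  have := bernoulliExp_mul_antitone_le hp (sub_nonneg.2 hf₁) hg₁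
    (fun a b h => sub_le_sub_left (hf h) 1) hg
  rw [sub_mul, one_mul, bernoulliExp_sub, bernoulliExp_sub, bernoulliExp_one] at this
  linarith

lemma sum_eq_sum_update (F : (E → Bool) → ℝ) (e : E) :
    ∑ ω, F ω = ∑ ω, if ω e then 0 else
      F (Function.update ω e true) + F (Function.update ω e false) := by
  have h : ∑ ω with ω e = true, F ω = ∑ ω with ¬ω e = true, F (Function.update ω e true) := by
    refine Finset.sum_nbij' (fun ω => Function.update ω e false)
      (fun ω => Function.update ω e true) ?_ ?_ ?_ ?_ ?_ <;>
    · intro ω hω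
      simp only [Finset.mem_filter, Finset.mem_univ, true_and, Bool.not_eq_true] at hω
      simp [← hω]
  rw [← Finset.sum_filter_add_sum_filter_not Finset.univ (fun ω : E → Bool => ω e = true) F, h,
    ← Finset.sum_add_distrib, Finset.sum_filter]
  refine Finset.sum_congr rfl fun ω _ => ?_
  cases hω : ω e <;> simp [← hω]

lemma bernoulliExp_split (p : E → ℝ) (f : (E → Bool) → ℝ) (e : E) :
    bernoulliExp p f =
      p e * bernoulliExp (Function.update p e 0) (fun ω => f (Function.update ω e true)) +
      (1 - p e) * bernoulliExp (Function.update p e 0) f := by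
  have hw : ∀ (q : E → ℝ) (ω : E → Bool), bernoulliWeight q ω =
      (if ω e then q e else 1 - q e) *
        ∏ i ∈ Finset.univ.erase e, if ω i then q i else 1 - q i := fun q ω =>
    (Finset.mul_prod_erase _ _ (Finset.mem_univ e)).symm
  have hr : ∀ (ω : E → Bool) (b : Bool),
      (∏ i ∈ Finset.univ.erase e, if Function.update ω e b i then p i else 1 - p i) =
        ∏ i ∈ Finset.univ.erase e, if ω i then p i else 1 - p i := fun ω b =>
    Finset.prod_congr rfl fun i hi => by simp [Function.update_of_ne (Finset.ne_of_mem_erase hi)]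
  have hq : ∀ (ω : E → Bool),
      (∏ i ∈ Finset.univ.erase e, if ω i then Function.update p e 0 i
        else 1 - Function.update p e 0 i) =
        ∏ i ∈ Finset.univ.erase e, if ω i then p i else 1 - p i := fun ω =>
    Finset.prod_congr rfl fun i hi => by simp [Function.update_of_ne (Finset.ne_of_mem_erase hi)]
  unfold bernoulliExp
  rw [sum_eq_sum_update _ e, Finset.mul_sum, Finset.mul_sum, ← Finset.sum_add_distrib]
  refine Finset.sum_congr rfl fun ω _ => ?_
  rw [hw p, hw p, hr, hr, hw (Function.update p e 0), hq]
  cases hω : ω e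
  · have : Function.update ω e false = ω := by simp [← hω]
    simp [this]
    ring
  · simp

/-- The four functions theorem on a two-point space. -/
lemma two_point_four_functions {q a₀ a₁ b₀ b₁ c₀ c₁ d₀ d₁ : ℝ} (hq₀ : 0 ≤ q) (hq₁ : q ≤ 1)
    (ha₀ : 0 ≤ a₀) (ha₁ : 0 ≤ a₁) (hb₀ : 0 ≤ b₀) (hb₁ : 0 ≤ b₁)
    (hc₀ : 0 ≤ c₀) (hc₁ : 0 ≤ c₁) (hd₀ : 0 ≤ d₀) (hd₁ : 0 ≤ d₁)
    (h₀₀ : a₀ * b₀ ≤ c₀ * d₀) (h₀₁ : a₀ * b₁ ≤ c₀ * d₁)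
    (h₁₀ : a₁ * b₀ ≤ c₀ * d₁) (h₁₁ : a₁ * b₁ ≤ c₁ * d₁) :
    (q * a₁ + (1 - q) * a₀) * (q * b₁ + (1 - q) * b₀) ≤
      (q * c₁ + (1 - q) * c₀) * (q * d₁ + (1 - q) * d₀) := by
  have hr : 0 ≤ 1 - q := sub_nonneg.2 hq₁
  have key := four_functions_theorem_univ (α := Bool)
    (fun i => if i then q * a₁ else (1 - q) * a₀) (fun i => if i then q * b₁ else (1 - q) * b₀)
    (fun i => if i then q * c₁ else (1 - q) * c₀) (fun i => if i then q * d₁ else (1 - q) * d₀)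
    (fun i => by cases i <;> simp <;> positivity) (fun i => by cases i <;> simp <;> positivity)
    (fun i => by cases i <;> simp <;> positivity) (fun i => by cases i <;> simp <;> positivity)
    (fun i j => by
      cases i <;> cases j <;> simp
      · nlinarith [mul_le_mul_of_nonneg_left h₀₀ (mul_nonneg hr hr)]
      · nlinarith [mul_le_mul_of_nonneg_left h₀₁ (mul_nonneg hr hq₀)]
      · nlinarith [mul_le_mul_of_nonneg_left h₁₀ (mul_nonneg hr hq₀)]
      · nlinarith [mul_le_mul_of_nonneg_left h₁₁ (mul_nonneg hq₀ hq₀)])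
  simpa using key

end Bernoulli

variable {V E : Type}

lemma adj_mono (G : PercGraph V E) {ω ω' : E → Bool} (h : ω ≤ ω') {x y : V}
    (hxy : G.adj ω x y) : G.adj ω' x y := by
  obtain ⟨e, he, hends⟩ := hxy
  exact ⟨e, h e he, hends⟩

lemma Conn.mono {G : PercGraph V E} {ω ω' : E → Bool} (h : ω ≤ ω') {x y : V}
    (hxy : G.Conn ω x y) : G.Conn ω' x y :=
  Relation.ReflTransGen.mono (fun _ _ => G.adj_mono h) _ _ hxy

lemma Conn.symm {G : PercGraph V E} {ω : E → Bool} {x y : V}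
    (hxy : G.Conn ω x y) : G.Conn ω y x :=
  Relation.ReflTransGen.mono (fun _ _ ⟨e, he, hends⟩ => ⟨e, he, hends.symm⟩) _ _
    (Relation.ReflTransGen.swap _ _ hxy)

lemma Conn.trans {G : PercGraph V E} {ω : E → Bool} {x y z : V}
    (hxy : G.Conn ω x y) (hyz : G.Conn ω y z) : G.Conn ω x z :=
  Relation.ReflTransGen.trans hxy hyz

lemma conn_of_incident {G : PercGraph V E} {ω : E → Bool} {e : E} (he : ω e = true) {x y : V}
    (hx : G.incident x e) (hy : G.incident y e) : G.Conn ω x y := by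
  rcases hx with rfl | rfl <;> rcases hy with rfl | rfl
  · exact .refl
  · exact .single ⟨e, he, .inl rfl⟩
  · exact .single ⟨e, he, .inr rfl⟩
  · exact .refl

lemma exists_incident_of_adj {G : PercGraph V E} {ω : E → Bool} {x y : V} (h : G.adj ω x y) :
    ∃ e, ω e = true ∧ G.incident x e ∧ G.incident y e := by
  obtain ⟨e, he, h | h⟩ := h
  · exact ⟨e, he, by simp [incident, h], by simp [incident, h]⟩
  · exact ⟨e, he, by simp [incident, h], by simp [incident, h]⟩

/-- The cluster of `s` is determined by the states of the edges incident to it. -/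
lemma conn_iff_of_eqOn {G : PercGraph V E} {ω ω' : E → Bool} {s : V}
    (h : ∀ e x, G.Conn ω s x → G.incident x e → ω e = ω' e) (y : V) :
    G.Conn ω s y ↔ G.Conn ω' s y := by
  constructor <;> intro hy
  · induction hy with
    | refl => exact .refl
    | tail hsx hxz ih =>
      obtain ⟨e, he, hx, hz⟩ := exists_incident_of_adj hxz
      exact ih.trans (conn_of_incident (h e _ hsx hx ▸ he) hx hz)
  · induction hy with
    | refl => exact .refl
    | tail hsx hxz ih =>
      obtain ⟨e, he, hx, hz⟩ := exists_incident_of_adj hxz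
      exact ih.trans (conn_of_incident ((h e _ ih hx).trans he) hx hz)

@[simp] lemma mem_cluster_singleton {G : PercGraph V E} {ω : E → Bool} {s y : V} :
    y ∈ G.cluster ω {s} ↔ G.Conn ω s y := by
  simp [cluster]

lemma cluster_eq_of_eqOn {G : PercGraph V E} {ω ω' : E → Bool} {s : V}
    (h : ∀ e x, G.Conn ω s x → G.incident x e → ω e = ω' e) :
    G.cluster ω {s} = G.cluster ω' {s} := by
  ext y
  simpa using conn_iff_of_eqOn h y

/-- The indicator function of the event `s ↮ T`. -/
noncomputable def disconnInd (G : PercGraph V E) (s : V) (T : Set V) : (E → Bool) → ℝ :=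
  {ω | ∀ t ∈ T, ¬G.Conn ω s t}.indicator 1

lemma disconnInd_eq_one {G : PercGraph V E} {s : V} {T : Set V} {ω : E → Bool}
    (h : ∀ t ∈ T, ¬G.Conn ω s t) : G.disconnInd s T ω = 1 :=
  Set.indicator_of_mem (s := {ω | ∀ t ∈ T, ¬G.Conn ω s t}) h 1

lemma disconnInd_eq_zero {G : PercGraph V E} {s t : V} {T : Set V} {ω : E → Bool}
    (ht : t ∈ T) (h : G.Conn ω s t) : G.disconnInd s T ω = 0 :=
  Set.indicator_of_notMem (s := {ω | ∀ t ∈ T, ¬G.Conn ω s t}) (fun h' => h' t ht h) 1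

lemma disconnInd_nonneg (G : PercGraph V E) (s : V) (T : Set V) : 0 ≤ G.disconnInd s T :=
  Set.indicator_nonneg fun _ _ => zero_le_one

lemma disconnInd_le_one (G : PercGraph V E) (s : V) (T : Set V) : G.disconnInd s T ≤ 1 :=
  Set.indicator_le_self' fun _ _ => zero_le_one

lemma disconnInd_antitone_set (G : PercGraph V E) (s : V) : Antitone (G.disconnInd s) :=
  fun _ _ hTU => Set.indicator_le_indicator_of_subset (fun _ hω t ht => hω t (hTU ht))
    fun _ => zero_le_one

lemma disconnInd_antitone (G : PercGraph V E) (s : V) (T : Set V) :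
    Antitone (G.disconnInd s T) := by
  intro ω ω' h
  by_cases hω : ∀ t ∈ T, ¬G.Conn ω s t
  · rw [disconnInd_eq_one hω]
    exact G.disconnInd_le_one s T ω'
  · push Not at hω
    obtain ⟨t, ht, hst⟩ := hω
    rw [disconnInd_eq_zero ht (hst.mono h)]
    exact G.disconnInd_nonneg s T ω

lemma disconnInd_union (G : PercGraph V E) (s : V) (T U : Set V) :
    G.disconnInd s (T ∪ U) = G.disconnInd s T * G.disconnInd s U := by
  unfold disconnInd
  rw [← Set.inter_indicator_one]
  congr 1
  ext ω
  simp [or_imp, forall_and]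

lemma disconnInd_clusterDetermined (G : PercGraph V E) (s : V) (T : Set V) :
    G.ClusterDetermined {s} (G.disconnInd s T) := by
  intro ω ω' h
  have : ∀ y, G.Conn ω s y ↔ G.Conn ω' s y := fun y => by
    rw [← mem_cluster_singleton, h, mem_cluster_singleton]
  have hmem : (∀ t ∈ T, ¬G.Conn ω s t) ↔ ∀ t ∈ T, ¬G.Conn ω' s t := by simp only [this]
  by_cases hω : ∀ t ∈ T, ¬G.Conn ω s t
  · rw [disconnInd_eq_one hω, disconnInd_eq_one (hmem.1 hω)]
  · have hω' := mt hmem.2 hω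
    push Not at hω hω'
    obtain ⟨t, ht, hst⟩ := hω
    obtain ⟨t', ht', hst'⟩ := hω'
    rw [disconnInd_eq_zero ht hst, disconnInd_eq_zero ht' hst']

lemma IncreasingEvent.monotone_indicator {S : Set (E → Bool)} (hS : IncreasingEvent S) :
    Monotone (S.indicator (1 : (E → Bool) → ℝ)) := by
  intro ω ω' h
  by_cases hω : ω ∈ S
  · simp [hω, hS h hω]
  · rw [Set.indicator_of_notMem hω]
    exact Set.indicator_nonneg (fun _ _ => zero_le_one) _

lemma increasingEvent_connEvent (G : PercGraph V E) (x y : V) :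
    IncreasingEvent (G.connEvent x y) :=
  fun _ _ h hω => Conn.mono h hω

lemma ClusterDeterminedEvent.indicator {G : PercGraph V E} {A : Set V} {S : Set (E → Bool)}
    (hS : G.ClusterDeterminedEvent A S) : G.ClusterDetermined A (S.indicator 1) := by
  intro ω ω' h
  by_cases hω : ω ∈ S
  · simp [hω, (hS ω ω' h).1 hω]
  · simp [hω, mt (hS ω ω' h).2 hω]

lemma clusterDeterminedEvent_connEvent (G : PercGraph V E) (x y : V) :
    G.ClusterDeterminedEvent {x} (G.connEvent x y) := by
  intro ω ω' h
  change G.Conn ω x y ↔ G.Conn ω' x y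
  rw [← mem_cluster_singleton, h, mem_cluster_singleton]

open Classical in
/-- The configuration equal to `ω` on the edges incident to `A` and to `ω'` elsewhere. -/
noncomputable def splice (G : PercGraph V E) (A : Set V) (ω ω' : E → Bool) : E → Bool :=
  fun e => if ∃ x ∈ A, G.incident x e then ω e else ω' e

lemma cluster_splice (G : PercGraph V E) (s : V) (ω ω' : E → Bool) :
    G.cluster (G.splice (G.cluster ω {s}) ω ω') {s} = G.cluster ω {s} := by
  refine (cluster_eq_of_eqOn fun e x hx hxe => ?_).symm
  rw [splice, if_pos ⟨x, mem_cluster_singleton.2 hx, hxe⟩]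

/-- Resample independently all edges not incident to the cluster of `s`. -/
noncomputable def resample (G : PercGraph V E) (s : V) (q : (E → Bool) × (E → Bool)) :
    (E → Bool) × (E → Bool) :=
  (G.splice (G.cluster q.1 {s}) q.1 q.2, G.splice (G.cluster q.1 {s}) q.2 q.1)

lemma resample_involutive (G : PercGraph V E) (s : V) : Function.Involutive (G.resample s) := by
  rintro ⟨ω, ω'⟩
  simp only [resample, cluster_splice]
  ext e <;> simp only [splice] <;> split_ifs <;> rfl

variable [Fintype E]

lemma bernoulliWeight_resample (G : PercGraph V E) (p : E → ℝ) (s : V)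
    (q : (E → Bool) × (E → Bool)) :
    bernoulliWeight p (G.resample s q).1 * bernoulliWeight p (G.resample s q).2 =
      bernoulliWeight p q.1 * bernoulliWeight p q.2 := by
  simp only [bernoulliWeight, ← Finset.prod_mul_distrib]
  refine Finset.prod_congr rfl fun e _ => ?_
  by_cases h : ∃ x ∈ G.cluster q.1 {s}, G.incident x e
  · simp only [resample, splice, if_pos h]
  · simp only [resample, splice, if_neg h, mul_comm]

variable [DecidableEq E]

/-- Conditioning on the state of an edge with an endpoint in `T`. -/
lemma bernoulliExp_mul_disconnInd_split (G : PercGraph V E) (p : E → ℝ) {s w v : V} {T : Set V}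
    {f : (E → Bool) → ℝ} (hf : G.ClusterDetermined {s} f) {e : E}
    (he : G.ends e = (w, v) ∨ G.ends e = (v, w)) (hw : w ∈ T) :
    bernoulliExp p (f * G.disconnInd s T) =
      p e * bernoulliExp (Function.update p e 0) (f * G.disconnInd s (T ∪ {v})) +
      (1 - p e) * bernoulliExp (Function.update p e 0) (f * G.disconnInd s T) := by
  rw [bernoulliExp_split p _ e]
  congr 2
  refine bernoulliExp_congr fun ω hω => ?_
  have hle : ω ≤ Function.update ω e true := by
    intro i
    by_cases h : i = e
    · subst h; simp
    · simp [h]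
  have hwe : G.incident w e := by rcases he with h | h <;> simp [incident, h]
  have hve : G.incident v e := by rcases he with h | h <;> simp [incident, h]
  simp only [Pi.mul_apply]
  by_cases hT : ∀ t ∈ T ∪ {v}, ¬G.Conn ω s t
  · have hC : G.cluster ω {s} = G.cluster (Function.update ω e true) {s} := by
      refine cluster_eq_of_eqOn fun i x hx hxi => ?_
      by_cases h : i = e
      · subst h
        have : x = w ∨ x = v := by
          rcases he with h | h <;> rcases hxi with h' | h' <;> simp_all
        rcases this with rfl | rfl
        · exact absurd hx (hT _ (.inl hw))
        · exact absurd hx (hT _ (.inr rfl))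
      · simp [h]
    rw [← hf _ _ hC, ← G.disconnInd_clusterDetermined s T _ _ hC, disconnInd_eq_one hT,
      disconnInd_eq_one fun t ht => hT t (.inl ht)]
  · push Not at hT
    obtain ⟨t, ht, hst⟩ := hT
    obtain ⟨t', ht', hst'⟩ : ∃ t' ∈ T, G.Conn (Function.update ω e true) s t' := by
      rcases ht with ht | rfl
      · exact ⟨t, ht, hst.mono hle⟩
      · exact ⟨w, hw, (hst.mono hle).trans (conn_of_incident (e := e) (by simp) hve hwe)⟩
    rw [disconnInd_eq_zero ht hst, disconnInd_eq_zero ht' hst', mul_zero, mul_zero]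

/-- The case of `bernoulliExp_disconnInd_mul_le` where no open edge meets `T ∩ U`. -/
lemma bernoulliExp_disconnInd_mul_le_of_isolated (G : PercGraph V E) {p : E → ℝ}
    (hp : ∀ e, 0 ≤ p e ∧ p e ≤ 1) {s : V} {f g : (E → Bool) → ℝ} (hf₀ : 0 ≤ f) (hg₀ : 0 ≤ g)
    (hf : Monotone f) (hg : Monotone g) {T U : Set V}
    (hTU : ∀ e w, w ∈ T ∩ U → G.incident w e → p e = 0) :
    bernoulliExp p (f * G.disconnInd s T) * bernoulliExp p (g * G.disconnInd s U) ≤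
      bernoulliExp p (f * g * G.disconnInd s (T ∩ U)) *
        bernoulliExp p (G.disconnInd s (T ∪ U)) := by
  have hN := G.disconnInd_nonneg s
  by_cases hs : s ∈ T ∩ U
  · have h0 : f * G.disconnInd s T = 0 := by
      ext ω
      simp [disconnInd_eq_zero (G := G) (ω := ω) hs.1 .refl]
    rw [h0]
    have : bernoulliExp p 0 = 0 := by simp [bernoulliExp]
    rw [this, zero_mul]
    exact mul_nonneg (bernoulliExp_nonneg hp (mul_nonneg (mul_nonneg hf₀ hg₀) (hN _)))
      (bernoulliExp_nonneg hp (hN _))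
  · have h1 : bernoulliExp p (f * g * G.disconnInd s (T ∩ U)) = bernoulliExp p (f * g) := by
      refine bernoulliExp_congr fun ω hω => ?_
      have : ∀ t ∈ T ∩ U, ¬G.Conn ω s t := by
        intro t ht hst
        rcases Relation.ReflTransGen.cases_tail hst with rfl | ⟨x, -, hxt⟩
        · exact hs ht
        · obtain ⟨e, he, -, hte⟩ := exists_incident_of_adj hxt
          exact hω e he (hTU e t ht hte)
      simp [disconnInd_eq_one this]
    rw [h1, disconnInd_union]
    calc bernoulliExp p (f * G.disconnInd s T) * bernoulliExp p (g * G.disconnInd s U)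
        ≤ (bernoulliExp p f * bernoulliExp p (G.disconnInd s T)) *
          (bernoulliExp p g * bernoulliExp p (G.disconnInd s U)) :=
          mul_le_mul
            (bernoulliExp_mul_antitone_le hp hf₀ (G.disconnInd_le_one s T) hf
              (G.disconnInd_antitone s T))
            (bernoulliExp_mul_antitone_le hp hg₀ (G.disconnInd_le_one s U) hg
              (G.disconnInd_antitone s U))
            (bernoulliExp_nonneg hp (mul_nonneg hg₀ (hN U)))
            (mul_nonneg (bernoulliExp_nonneg hp hf₀) (bernoulliExp_nonneg hp (hN T)))
      _ = (bernoulliExp p f * bernoulliExp p g) *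
          (bernoulliExp p (G.disconnInd s T) * bernoulliExp p (G.disconnInd s U)) := by ring
      _ ≤ _ := mul_le_mul (bernoulliExp_mul_le hp hf₀ hg₀ hf hg)
          (bernoulliExp_antitone_mul_le hp (G.disconnInd_le_one s T) (G.disconnInd_le_one s U)
            (G.disconnInd_antitone s T) (G.disconnInd_antitone s U))
          (mul_nonneg (bernoulliExp_nonneg hp (hN T)) (bernoulliExp_nonneg hp (hN U)))
          (bernoulliExp_nonneg hp (mul_nonneg hf₀ hg₀))

/-- The van den Berg–Häggström–Kahn inequality, in four functions form. -/
lemma bernoulliExp_disconnInd_mul_le (G : PercGraph V E) {p : E → ℝ}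
    (hp : ∀ e, 0 ≤ p e ∧ p e ≤ 1) {s : V} {f g : (E → Bool) → ℝ} (hf₀ : 0 ≤ f) (hg₀ : 0 ≤ g)
    (hf : Monotone f) (hg : Monotone g) (hfC : G.ClusterDetermined {s} f)
    (hgC : G.ClusterDetermined {s} g) (T U : Set V) :
    bernoulliExp p (f * G.disconnInd s T) * bernoulliExp p (g * G.disconnInd s U) ≤
      bernoulliExp p (f * g * G.disconnInd s (T ∩ U)) *
        bernoulliExp p (G.disconnInd s (T ∪ U)) := by
  classical
  induction hn : (Finset.univ.filter fun e => p e ≠ 0).card using Nat.strong_induction_on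
    generalizing p T U with
  | _ n ih =>
  by_cases hTU : ∀ e w, w ∈ T ∩ U → G.incident w e → p e = 0
  · exact G.bernoulliExp_disconnInd_mul_le_of_isolated hp hf₀ hg₀ hf hg hTU
  push Not at hTU
  obtain ⟨e, w, hw, hwe, hpe⟩ := hTU
  obtain ⟨v, he⟩ : ∃ v, G.ends e = (w, v) ∨ G.ends e = (v, w) := by
    rcases hwe with rfl | rfl
    · exact ⟨_, .inl rfl⟩
    · exact ⟨_, .inr rfl⟩
  have hfgC : G.ClusterDetermined {s} (f * g) := fun ω ω' h => by
    simp [hfC ω ω' h, hgC ω ω' h]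
  have h1C : G.ClusterDetermined {s} 1 := fun _ _ _ => rfl
  have hsplit := G.bernoulliExp_mul_disconnInd_split p (T := T ∪ U) h1C he (.inl hw.1)
  simp only [one_mul] at hsplit
  rw [hsplit, G.bernoulliExp_mul_disconnInd_split p hfC he hw.1,
    G.bernoulliExp_mul_disconnInd_split p hgC he hw.2,
    G.bernoulliExp_mul_disconnInd_split p hfgC he hw]
  set p' := Function.update p e 0
  have hp' : ∀ i, 0 ≤ p' i ∧ p' i ≤ 1 := by
    intro i
    by_cases h : i = e
    · subst h; simp [p']
    · simpa [p', h] using hp i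
  have hlt : (Finset.univ.filter fun i => p' i ≠ 0).card < n := by
    rw [← hn]
    refine Finset.card_lt_card ((Finset.ssubset_iff_of_subset ?_).2 ⟨e, by simpa using hpe, ?_⟩)
    · intro i
      by_cases h : i = e
      · subst h; simp [p']
      · simp [p', h]
    · simp [p']
  have key := fun T U => ih _ hlt hp' T U rfl
  have hfg₀ : 0 ≤ f * g := mul_nonneg hf₀ hg₀
  have hN := G.disconnInd_nonneg s
  have hnn : ∀ {h : (E → Bool) → ℝ} (T : Set V), 0 ≤ h →
      0 ≤ bernoulliExp p' (h * G.disconnInd s T) := fun T h₀ =>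
    bernoulliExp_nonneg hp' (mul_nonneg h₀ (hN T))
  have hmono : ∀ {T' U' : Set V}, T ∩ U ⊆ T' ∩ U' →
      bernoulliExp p' (f * g * G.disconnInd s (T' ∩ U')) ≤
        bernoulliExp p' (f * g * G.disconnInd s (T ∩ U)) := fun h =>
    bernoulliExp_mono hp' (mul_le_mul_of_nonneg_left (G.disconnInd_antitone_set s h) hfg₀)
  refine two_point_four_functions (hp e).1 (hp e).2 (hnn _ hf₀) (hnn _ hf₀) (hnn _ hg₀)
    (hnn _ hg₀) (hnn _ hfg₀) (hnn _ hfg₀) (bernoulliExp_nonneg hp' (hN _))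
    (bernoulliExp_nonneg hp' (hN _)) (key T U) ?_ ?_ ?_
  · have := key T (U ∪ {v})
    rw [← Set.union_assoc] at this
    exact this.trans (mul_le_mul_of_nonneg_right
      (hmono (Set.inter_subset_inter_right _ Set.subset_union_left))
      (bernoulliExp_nonneg hp' (hN _)))
  · have := key (T ∪ {v}) U
    rw [Set.union_right_comm] at this
    exact this.trans (mul_le_mul_of_nonneg_right
      (hmono (Set.inter_subset_inter_left _ Set.subset_union_left))
      (bernoulliExp_nonneg hp' (hN _)))
  · have := key (T ∪ {v}) (U ∪ {v})
    rwa [← Set.inter_union_distrib_right, ← Set.union_union_distrib_right] at this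

/-- The expectation of `g` after closing all edges incident to the cluster of `s` in `ω`. -/
noncomputable def expAvoiding (G : PercGraph V E) (p : E → ℝ) (s : V) (g : (E → Bool) → ℝ)
    (ω : E → Bool) : ℝ :=
  bernoulliExp p fun ω' => g (G.splice (G.cluster ω {s}) ⊥ ω')

/-- The Markov property of cluster exploration. -/
lemma bernoulliExp_mul_expAvoiding (G : PercGraph V E) (p : E → ℝ) {s : V}
    {f : (E → Bool) → ℝ} (hf : G.ClusterDetermined {s} f) (g : (E → Bool) → ℝ) :
    bernoulliExp p (f * G.expAvoiding p s g) =
      bernoulliExp p fun ω => f ω * g (G.splice (G.cluster ω {s}) ⊥ ω) := by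
  have h := Equiv.sum_comp (G.resample_involutive s).toPerm
    fun q : (E → Bool) × (E → Bool) => f q.1 * g (G.splice (G.cluster q.1 {s}) ⊥ q.2) *
      (bernoulliWeight p q.1 * bernoulliWeight p q.2)
  have hg : ∀ (A : Set V) (ω ω' : E → Bool),
      G.splice A ⊥ (G.splice A ω' ω) = G.splice A ⊥ ω := by
    intro A ω ω'
    ext e
    simp only [splice]
    split_ifs <;> rfl
  have hfr : ∀ q, f (G.resample s q).1 = f q.1 := fun q => hf _ _ (G.cluster_splice s _ _)
  simp only [Function.Involutive.coe_toPerm, bernoulliWeight_resample, hfr] at h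
  simp only [resample, cluster_splice, hg] at h
  rw [Fintype.sum_prod_type, Fintype.sum_prod_type] at h
  calc bernoulliExp p (f * G.expAvoiding p s g)
      = ∑ ω, ∑ ω', f ω * g (G.splice (G.cluster ω {s}) ⊥ ω') *
          (bernoulliWeight p ω * bernoulliWeight p ω') := by
        simp only [bernoulliExp, expAvoiding, Pi.mul_apply, Finset.mul_sum, Finset.sum_mul]
        refine Finset.sum_congr rfl fun ω _ => Finset.sum_congr rfl fun ω' _ => ?_
        ring
    _ = _ := by
        rw [← h]
        refine Finset.sum_congr rfl fun ω _ => ?_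
        simp only
        rw [← Finset.mul_sum, ← Finset.mul_sum, sum_bernoulliWeight, mul_one]

/-- Negative correlation of the clusters of `s` and `t` conditionally on `s ↮ t`. -/
lemma bernoulliExp_mul_conn_disconnInd_le (G : PercGraph V E) {p : E → ℝ}
    (hp : ∀ e, 0 ≤ p e ∧ p e ≤ 1) {s t b : V} {f : (E → Bool) → ℝ} (hf₀ : 0 ≤ f)
    (hf : Monotone f) (hfC : G.ClusterDetermined {s} f) :
    bernoulliExp p (f * (G.connEvent t b).indicator 1 * G.disconnInd s {t}) *
        bernoulliExp p (G.disconnInd s {t}) ≤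
      bernoulliExp p (f * G.disconnInd s {t}) *
        bernoulliExp p ((G.connEvent t b).indicator 1 * G.disconnInd s {t}) := by
  set g : (E → Bool) → ℝ := (G.connEvent t b).indicator 1 with hg_def
  set N := G.disconnInd s {t} with hN_def
  have hg := (G.increasingEvent_connEvent t b).monotone_indicator
  have hg₁ : g ≤ 1 := Set.indicator_le_self' fun _ _ => zero_le_one
  have hNC := G.disconnInd_clusterDetermined s {t}
  have hgN : ∀ ω, N ω * g (G.splice (G.cluster ω {s}) ⊥ ω) = g ω * N ω := by
    intro ω
    by_cases hst : G.Conn ω s t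
    · simp [N, disconnInd_eq_zero (G := G) (Set.mem_singleton t) hst]
    · have : G.Conn ω t b ↔ G.Conn (G.splice (G.cluster ω {s}) ⊥ ω) t b := by
        refine conn_iff_of_eqOn (fun e x hx hxe => ?_) b
        simp only [splice]
        split_ifs with h
        · obtain ⟨y, hy, hye⟩ := h
          rw [mem_cluster_singleton] at hy
          refine Bool.eq_false_iff.2 fun he => hst ((hy.trans (conn_of_incident he hye hxe)).trans hx.symm)
        · rfl
      have hgω : g (G.splice (G.cluster ω {s}) ⊥ ω) = g ω := by
        by_cases h : ω ∈ G.connEvent t b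
        · simp [hg_def, h, show G.splice _ ⊥ ω ∈ G.connEvent t b from this.1 h]
        · simp [hg_def, h, show G.splice _ ⊥ ω ∉ G.connEvent t b from mt this.2 h]
      rw [hgω, mul_comm]
  have hmarkov : ∀ {k : (E → Bool) → ℝ}, G.ClusterDetermined {s} k →
      bernoulliExp p (k * N * G.expAvoiding p s g) = bernoulliExp p (k * g * N) := by
    intro k hk
    rw [G.bernoulliExp_mul_expAvoiding p (f := k * N) (fun ω ω' h => by
      simp only [Pi.mul_apply, hk ω ω' h, N, hNC ω ω' h])]
    congr 1
    ext ω
    simp only [Pi.mul_apply, mul_assoc, hgN]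
  have hA₁ : G.expAvoiding p s g ≤ 1 := fun ω => by
    exact (bernoulliExp_mono hp (g := 1) fun ω' => hg₁ (G.splice _ ⊥ ω')).trans_eq
      (bernoulliExp_one p)
  have hA : Antitone (G.expAvoiding p s g) := by
    intro ω ω' h
    refine bernoulliExp_mono hp fun η => hg fun e => ?_
    simp only [splice]
    split_ifs with h₁ h₂
    · exact le_rfl
    · exact bot_le
    · obtain ⟨x, hx, hxe⟩ := ‹∃ x ∈ G.cluster ω {s}, G.incident x e›
      refine absurd ⟨x, ?_, hxe⟩ h₁
      rw [mem_cluster_singleton] at hx ⊢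
      exact hx.mono h
    · exact le_rfl
  have key := G.bernoulliExp_disconnInd_mul_le hp hf₀ (sub_nonneg.2 hA₁) hf
    (fun a b h => sub_le_sub_left (hA h) 1) hfC
    (fun ω ω' h => by simp [expAvoiding, h]) {t} {t}
  have h1 := hmarkov (k := 1) (fun _ _ _ => rfl)
  have h2 := hmarkov hfC
  rw [one_mul, one_mul] at h1
  rw [Set.inter_self, Set.union_self, ← hN_def, sub_mul, one_mul, mul_sub, mul_one, sub_mul,
    bernoulliExp_sub, bernoulliExp_sub, mul_comm (G.expAvoiding p s g) N, h1,
    mul_right_comm f, h2] at key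
  linarith

lemma prob_eq_bernoulliExp (G : PercGraph V E) (S : Set (E → Bool)) :
    G.prob S = bernoulliExp G.p (S.indicator 1) := by
  refine Finset.sum_congr rfl fun ω => ?_
  by_cases h : ω ∈ S <;> simp [h, weight, bernoulliWeight]

lemma prob_inter_eq_bernoulliExp (G : PercGraph V E) (S T : Set (E → Bool)) :
    G.prob (S ∩ T) = bernoulliExp G.p (T.indicator 1 * S.indicator 1) := by
  rw [prob_eq_bernoulliExp, Set.inter_indicator_one, mul_comm]

/-- On the event that `s` and `t` are connected, `s ↔ b` and `t ↔ b` agree. -/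
lemma bernoulliExp_mul_conn_sub (G : PercGraph V E) (p : E → ℝ) (s t b : V)
    (f : (E → Bool) → ℝ) :
    bernoulliExp p (f * (G.connEvent t b).indicator 1) -
        bernoulliExp p (f * (G.connEvent s b).indicator 1) =
      bernoulliExp p (f * (G.connEvent t b).indicator 1 * G.disconnInd s {t}) -
        bernoulliExp p (f * (G.connEvent s b).indicator 1 * G.disconnInd s {t}) := by
  rw [← bernoulliExp_sub, ← bernoulliExp_sub]
  congr 1
  ext ω
  simp only [Pi.sub_apply, Pi.mul_apply]
  by_cases hst : G.Conn ω s t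
  · have : ω ∈ G.connEvent t b ↔ ω ∈ G.connEvent s b :=
      ⟨fun h => hst.trans h, fun h => hst.symm.trans h⟩
    by_cases h : ω ∈ G.connEvent s b
    · simp [disconnInd_eq_zero (G := G) (Set.mem_singleton t) hst, h, this.2 h]
    · simp [disconnInd_eq_zero (G := G) (Set.mem_singleton t) hst, h, mt this.1 h]
  · rw [disconnInd_eq_one (G := G) (T := {t}) (by simpa using hst), mul_one, mul_one]

end PercGraph

/-- comparison lemma, conditional version for an increasing event
determined by the cluster of `a₂`. -/
theorem compare_cond_increasing
    {V E : Type} [DecidableEq V] [Fintype E] [DecidableEq E]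
    (G : PercGraph V E) (hp : G.ProbValid) (a₁ a₂ b : V) (δ : ℝ) (hδ : 0 < δ)
    (h : G.prob (G.connEvent a₁ b) < G.prob (G.connEvent a₂ b) + δ)
    (Q : Set (E → Bool)) (hQinc : PercGraph.IncreasingEvent Q)
    (hQdet : G.ClusterDeterminedEvent {a₂} Q) :
    G.condProb (G.connEvent a₁ b) Q < G.condProb (G.connEvent a₂ b) Q + δ := by
  have hq₀ : (0 : (E → Bool) → ℝ) ≤ Q.indicator 1 :=
    Set.indicator_nonneg fun _ _ => zero_le_one
  have hc₀ : ∀ x, (0 : (E → Bool) → ℝ) ≤ (G.connEvent x b).indicator 1 := fun x =>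
    Set.indicator_nonneg fun _ _ => zero_le_one
  have hc₁ : ∀ x, (G.connEvent x b).indicator (1 : (E → Bool) → ℝ) ≤ 1 := fun x =>
    Set.indicator_le_self' fun _ _ => zero_le_one
  have hN₀ := G.disconnInd_nonneg a₂ {a₁}
  have hneg := G.bernoulliExp_mul_conn_disconnInd_le hp (t := a₁) (b := b) hq₀
    hQinc.monotone_indicator hQdet.indicator
  have hpos := G.bernoulliExp_disconnInd_mul_le hp hq₀ (hc₀ a₂) hQinc.monotone_indicator
    (G.increasingEvent_connEvent a₂ b).monotone_indicator hQdet.indicator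
    (G.clusterDeterminedEvent_connEvent a₂ b).indicator {a₁} {a₁}
  rw [Set.inter_self, Set.union_self] at hpos
  have hfkg := PercGraph.bernoulliExp_mul_antitone_le hp hq₀ (G.disconnInd_le_one a₂ {a₁})
    hQinc.monotone_indicator (G.disconnInd_antitone a₂ {a₁})
  have hsub := G.bernoulliExp_mul_conn_sub G.p a₂ a₁ b 1
  have hsubQ := G.bernoulliExp_mul_conn_sub G.p a₂ a₁ b (Q.indicator 1)
  simp only [one_mul] at hsub
  rw [G.prob_eq_bernoulliExp, G.prob_eq_bernoulliExp] at h
  rw [PercGraph.condProb, PercGraph.condProb, G.prob_inter_eq_bernoulliExp,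
    G.prob_inter_eq_bernoulliExp, G.prob_eq_bernoulliExp Q]
  have hq_exp := PercGraph.bernoulliExp_nonneg hp hq₀
  have hN_exp := PercGraph.bernoulliExp_nonneg hp hN₀
  have hqc₁ := PercGraph.bernoulliExp_mono hp
    (mul_le_mul_of_nonneg_right (mul_le_of_le_one_right hq₀ (hc₁ a₁)) hN₀)
  have hqc₂ := PercGraph.bernoulliExp_nonneg hp (mul_nonneg (mul_nonneg hq₀ (hc₀ a₂)) hN₀)
  have hqN := PercGraph.bernoulliExp_nonneg hp (mul_nonneg hq₀ hN₀)
  rcases hq_exp.eq_or_lt with hq | hq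
  · simpa [← hq] using hδ
  rw [div_add' _ _ _ hq.ne', div_lt_div_iff_of_pos_right hq, ← sub_lt_iff_lt_add', hsubQ]
  rcases hqN.eq_or_lt with hz | hz
  · linarith [mul_pos hδ hq]
  have hN_pos := pos_of_mul_pos_right (hz.trans_le hfkg) hq_exp
  refine lt_of_mul_lt_mul_right ?_ hN_exp
  calc _ ≤ _ := by rw [sub_mul]; linarith
    _ < PercGraph.bernoulliExp G.p (Q.indicator 1 * G.disconnInd a₂ {a₁}) * δ :=
        mul_lt_mul_of_pos_left (hsub ▸ sub_lt_iff_lt_add'.2 h) hz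
    _ ≤ _ := by nlinarith
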